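/- Let μ be a positive Borel measure on ℝ with ∫_ℝ dμ(t)/(1+t²) < ∞, let r0 > 0, and let ξ be a positive Borel measure on [r0,∞). Set ξ⃗(r) = ξ([r0,r)) for r ≥ r0. Then ∫_{[r0,∞)} (1/r)·P_μ(ir) dξ(r) < ∞ if and only if ∫_{r0}^∞ μ↔(r)·ξ⃗(r)/r³ dr < ∞. -/

import Mathlib

open MeasureTheory Filter Topology Matrix Set
open scoped ENNReal

noncomputable section

/-- The symplectic matrix `J = [[0,-1],[1,0]]` (real version). -/
def Jmat : Matrix (Fin 2) (Fin 2) ℝ := !![0, -1; 1, 0]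

/-- The symplectic matrix `J` (complex version). -/
def JmatC : Matrix (Fin 2) (Fin 2) ℂ := !![0, -1; 1, 0]

/-- `|J| = [[0,1],[1,0]]`. -/
def Jabs : Matrix (Fin 2) (Fin 2) ℝ := !![0, 1; 1, 0]

/-- The entrywise comparison `|U| ⪯ V`. -/
def entryAbsLe (U V : Matrix (Fin 2) (Fin 2) ℝ) : Prop :=
  ∀ i j, |U i j| ≤ V i j

/-- The filter describing `t → b⁻`, `t` ranging over the reals, `b : EReal`. -/
def toBFilter (b : EReal) : Filter ℝ :=
  Filter.comap (fun t : ℝ => (t : EReal)) (nhdsWithin b (Set.Iio b))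

/-- `H` is a Hamiltonian on `[a, b)`. -/
structure IsHamiltonian (a : ℝ) (b : EReal) (H : ℝ → Matrix (Fin 2) (Fin 2) ℝ) : Prop where
  a_lt_b : (a : EReal) < b
  posSemidef : ∀ᵐ (t : ℝ) ∂volume, a ≤ t → (t : EReal) < b → (H t).PosSemidef
  locInt : ∀ (i j : Fin 2) (t : ℝ), a ≤ t → (t : EReal) < b →
    IntervalIntegrable (fun s => H s i j) volume a t
  zero_null : volume {t : ℝ | a ≤ t ∧ (t : EReal) < b ∧ H t = 0} = 0
  limit_point : (∫⁻ t in {t : ℝ | a ≤ t ∧ (t : EReal) < b},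
    ENNReal.ofReal ((H t).trace)) = ⊤

/-- `m1(t) = ∫_a^t h1`. -/
def m1 (a : ℝ) (H : ℝ → Matrix (Fin 2) (Fin 2) ℝ) (t : ℝ) : ℝ := ∫ s in a..t, H s 0 0

/-- `m2(t) = ∫_a^t h2`. -/
def m2 (a : ℝ) (H : ℝ → Matrix (Fin 2) (Fin 2) ℝ) (t : ℝ) : ℝ := ∫ s in a..t, H s 1 1

/-- `m3(t) = ∫_a^t h3`. -/
def m3 (a : ℝ) (H : ℝ → Matrix (Fin 2) (Fin 2) ℝ) (t : ℝ) : ℝ := ∫ s in a..t, H s 0 1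

/-- `M(t) = ∫_a^t H(s) ds`. -/
def Mmat (a : ℝ) (H : ℝ → Matrix (Fin 2) (Fin 2) ℝ) (t : ℝ) : Matrix (Fin 2) (Fin 2) ℝ :=
  !![m1 a H t, m3 a H t; m3 a H t, m2 a H t]

/-- Neither diagonal entry of `H` vanishes a.e. on any neighbourhood of `a`. -/
def DiagNonVanishing (a : ℝ) (b : EReal) (H : ℝ → Matrix (Fin 2) (Fin 2) ℝ) : Prop :=
  (∀ t : ℝ, a < t → (t : EReal) < b →
    ¬ ∀ᵐ s ∂(volume.restrict (Set.Ioo a t)), H s 0 0 = 0) ∧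
  (∀ t : ℝ, a < t → (t : EReal) < b →
    ¬ ∀ᵐ s ∂(volume.restrict (Set.Ioo a t)), H s 1 1 = 0)

/-- `W` is the fundamental solution of `W(t,z)J − J = z ∫_a^t W(s,z)H(s) ds`. -/
def IsFundamentalSolution (a : ℝ) (b : EReal) (H : ℝ → Matrix (Fin 2) (Fin 2) ℝ)
    (W : ℝ → ℂ → Matrix (Fin 2) (Fin 2) ℂ) : Prop :=
  ∀ (z : ℂ) (t : ℝ), a ≤ t → (t : EReal) < b →
    W t z * JmatC - JmatC =
      z • Matrix.of fun i j =>
        ∫ s in a..t, (W s z * (H s).map (fun x : ℝ => (x : ℂ))) i j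

/-- `qH` is the Weyl coefficient of the Hamiltonian `H`. -/
def IsWeylCoefficient (a : ℝ) (b : EReal) (H : ℝ → Matrix (Fin 2) (Fin 2) ℝ)
    (qH : ℂ → ℂ) : Prop :=
  ∃ W : ℝ → ℂ → Matrix (Fin 2) (Fin 2) ℂ,
    IsFundamentalSolution a b H W ∧
    ∀ z : ℂ, z.im ≠ 0 → ∀ ζ : ℂ, 0 ≤ ζ.im →
      Tendsto (fun t : ℝ =>
          (W t z 0 0 * ζ + W t z 0 1) / (W t z 1 0 * ζ + W t z 1 1))
        (toBFilter b) (nhds (qH z))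

/-- `μ` is the spectral measure of `H`, i.e. the measure in the Herglotz
representation of the Weyl coefficient of `H`. -/
def IsSpectralMeasure (a : ℝ) (b : EReal) (H : ℝ → Matrix (Fin 2) (Fin 2) ℝ)
    (μ : Measure ℝ) : Prop :=
  ∃ qH : ℂ → ℂ, IsWeylCoefficient a b H qH ∧
    (∫⁻ t : ℝ, ENNReal.ofReal (1 / (1 + t ^ 2)) ∂μ) < ⊤ ∧
    ∃ α β : ℝ, 0 ≤ β ∧ ∀ z : ℂ, z.im ≠ 0 →
      qH z = (α : ℂ) + (β : ℂ) * z +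
        ∫ t : ℝ, (1 / ((t : ℂ) - z) - (t : ℂ) / (1 + (t : ℂ) ^ 2)) ∂μ

/-- `μ↔(r) = μ((−r, r))`. -/
def muSym (μ : Measure ℝ) (r : ℝ) : ℝ≥0∞ := μ (Set.Ioo (-r) r)

/-- Poisson integral of a measure. -/
def poisson (μ : Measure ℝ) (z : ℂ) : ℝ := ∫ t : ℝ, (1 / ((t : ℂ) - z)).im ∂μ

/-- `g : (0,∞) → (0,∞)` is regularly varying with index `ρ`. -/
def RegularlyVarying (g : ℝ → ℝ) (ρ : ℝ) : Prop :=
  Measurable g ∧ (∀ r : ℝ, 0 < r → 0 < g r) ∧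
  ∀ l : ℝ, 0 < l → Tendsto (fun r : ℝ => g (l * r) / g r) atTop (nhds (l ^ ρ))

/-- `g⋆(r) = ∫_1^r t/g(t) dt`. -/
def gstar (g : ℝ → ℝ) (r : ℝ) : ℝ := ∫ t in (1:ℝ)..r, t / g t

/-- The Kac class `𝓜_g`. -/
def memMg (g : ℝ → ℝ) (μ : Measure ℝ) : Prop :=
  (∫⁻ r in Set.Ici (1:ℝ), ENNReal.ofReal (1 / g r)
    ∂(Measure.map (fun t : ℝ => |t|) μ)) < ⊤

/-- The class `𝓜̂_g`. -/
def memMhat (g : ℝ → ℝ) (μ : Measure ℝ) : Prop :=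
  (∫⁻ r in Set.Ioi (1:ℝ), muSym μ r * ENNReal.ofReal (gstar g r / r ^ 3)) < ⊤

/-- The class `𝓕_g`: `μ↔(r) = O(g(r))`. -/
def memFg (g : ℝ → ℝ) (μ : Measure ℝ) : Prop :=
  ∃ C : ℝ, ∀ᶠ r in atTop, muSym μ r ≤ ENNReal.ofReal (C * g r)

/-- The class `𝓕_g⁰`: `μ↔(r) = o(g(r))`. -/
def memFg0 (g : ℝ → ℝ) (μ : Measure ℝ) : Prop :=
  ∀ ε : ℝ, 0 < ε → ∀ᶠ r in atTop, muSym μ r ≤ ENNReal.ofReal (ε * g r)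

/-- `M⁺(t)`. -/
def MplusMat (a : ℝ) (H : ℝ → Matrix (Fin 2) (Fin 2) ℝ) (t : ℝ) :
    Matrix (Fin 2) (Fin 2) ℝ :=
  !![m1 a H t, Real.sqrt (m1 a H t * m2 a H t);
     Real.sqrt (m1 a H t * m2 a H t), m2 a H t]

/-- `m⁺(t) = 2√(m1(t)m2(t))`. -/
def mplus (a : ℝ) (H : ℝ → Matrix (Fin 2) (Fin 2) ℝ) (t : ℝ) : ℝ :=
  2 * Real.sqrt (m1 a H t * m2 a H t)

/-- `W` is the sequence of power series coefficients of the fundamental solution: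
`W_0 = I`, `W_{n+1}(t) = (∫_a^t W_n H)·(−J)`. -/
def IsCoeffSeq (a : ℝ) (H : ℝ → Matrix (Fin 2) (Fin 2) ℝ)
    (W : ℕ → ℝ → Matrix (Fin 2) (Fin 2) ℝ) : Prop :=
  (∀ t : ℝ, W 0 t = 1) ∧
  ∀ (n : ℕ) (t : ℝ),
    W (n + 1) t = (Matrix.of fun i j => ∫ s in a..t, (W n s * H s) i j) * (-Jmat)

/-- Entrywise integral of a matrix-valued function. -/
def intMat (f : ℝ → Matrix (Fin 2) (Fin 2) ℝ) (a t : ℝ) : Matrix (Fin 2) (Fin 2) ℝ :=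
  Matrix.of fun i j => ∫ s in a..t, f s i j

/-- `α_{n,m}(t) = ∫_a^t W_n H W_m* ds`. -/
def alphaMat (a : ℝ) (H : ℝ → Matrix (Fin 2) (Fin 2) ℝ)
    (W : ℕ → ℝ → Matrix (Fin 2) (Fin 2) ℝ) (n m : ℕ) (t : ℝ) :
    Matrix (Fin 2) (Fin 2) ℝ :=
  intMat (fun s => W n s * H s * (W m s)ᵀ) a t

/-- `β_{n,m}(t) = W_n(t) J W_m(t)*`. -/
def betaMat (W : ℕ → ℝ → Matrix (Fin 2) (Fin 2) ℝ) (n m : ℕ) (t : ℝ) :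
    Matrix (Fin 2) (Fin 2) ℝ :=
  W n t * Jmat * (W m t)ᵀ

/-- `∇(t,z) = ∫_a^t W(s,z) H(s) W(s,z)* ds`. -/
def nablaMat (a : ℝ) (H : ℝ → Matrix (Fin 2) (Fin 2) ℝ)
    (W : ℝ → ℂ → Matrix (Fin 2) (Fin 2) ℂ) (t : ℝ) (z : ℂ) :
    Matrix (Fin 2) (Fin 2) ℂ :=
  Matrix.of fun i j =>
    ∫ s in a..t, (W s z * (H s).map (fun x : ℝ => (x : ℂ)) * (W s z)ᴴ) i j

/-- Generalised inverse of `f : [a,b) → ℝ`. -/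
def genInv (a : ℝ) (b : EReal) (f : ℝ → ℝ) (y : ℝ) : ℝ :=
  sInf {x : ℝ | a ≤ x ∧ (x : EReal) < b ∧ y ≤ f x}

/-- Generalised inverse of `f : [0,b) → [0,∞]`. -/
def genInvE (b : EReal) (f : ℝ → ℝ≥0∞) (y : ℝ) : ℝ :=
  sInf {x : ℝ | 0 ≤ x ∧ (x : EReal) < b ∧ ENNReal.ofReal y ≤ f x}

/-- Tonelli's theorem for the region `{(x, s) | φ x < s}`. -/
theorem lintegral_lintegral_Ioi_comp {α : Type*} [MeasurableSpace α] (ν : Measure α) [SFinite ν]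
    {φ : α → ℝ} (hφ : Measurable φ) {w : ℝ → ℝ≥0∞} (hw : Measurable w) :
    ∫⁻ x, (∫⁻ s in Ioi (φ x), w s) ∂ν = ∫⁻ s, w s * ν {x | φ x < s} := by
  have hm : MeasurableSet {p : α × ℝ | φ p.1 < p.2} :=
    measurableSet_lt (hφ.comp measurable_fst) measurable_snd
  have hmeas : Measurable
      ({p : α × ℝ | φ p.1 < p.2}.indicator (fun p : α × ℝ => w p.2)) :=
    (hw.comp measurable_snd).indicator hm
  calc ∫⁻ x, (∫⁻ s in Ioi (φ x), w s) ∂ν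
      = ∫⁻ x, (∫⁻ s, {p : α × ℝ | φ p.1 < p.2}.indicator (fun p => w p.2) (x, s)) ∂ν := by
        refine lintegral_congr fun x => ?_
        rw [← lintegral_indicator measurableSet_Ioi]
        rfl
    _ = ∫⁻ s, ∫⁻ x, {p : α × ℝ | φ p.1 < p.2}.indicator (fun p => w p.2) (x, s) ∂ν :=
        lintegral_lintegral_swap
          (f := fun x s => {p : α × ℝ | φ p.1 < p.2}.indicator (fun p => w p.2) (x, s))
          hmeas.aemeasurable
    _ = ∫⁻ s, w s * ν {x | φ x < s} := by
        refine lintegral_congr fun s => ?_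
        rw [← lintegral_indicator_const (measurableSet_lt hφ measurable_const)]
        rfl

theorem lintegral_Ioi_ofReal_one_div_cube {x : ℝ} (hx : 0 < x) :
    ∫⁻ s in Ioi x, ENNReal.ofReal (1 / s ^ 3) = ENNReal.ofReal (1 / (2 * x ^ 2)) := by
  have hrpow : ∀ s ∈ Ioi x, 1 / s ^ 3 = s ^ (-3 : ℝ) := fun s hs => by
    rw [Real.rpow_neg (hx.trans hs).le, one_div]
    norm_cast
  have hint : IntegrableOn (fun s : ℝ => 1 / s ^ 3) (Ioi x) :=
    (integrableOn_congr_fun hrpow measurableSet_Ioi).2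
      (integrableOn_Ioi_rpow_of_lt (by norm_num) hx)
  rw [← ofReal_integral_eq_lintegral_ofReal hint, setIntegral_congr_fun measurableSet_Ioi hrpow,
    integral_Ioi_rpow_of_lt (by norm_num) hx]
  · congr 1
    rw [show (-3 : ℝ) + 1 = -2 by norm_num, Real.rpow_neg hx.le]
    norm_cast
    field_simp
    norm_num
  · filter_upwards [ae_restrict_mem measurableSet_Ioi] with s hs
    have : 0 < s := hx.trans hs
    show 0 ≤ 1 / s ^ 3
    positivity

theorem sFinite_of_lintegral_lt_top {α : Type*} [MeasurableSpace α] {ν : Measure α}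
    {f : α → ℝ≥0∞} (hf : Measurable f) (hf0 : ∀ x, f x ≠ 0) (hftop : ∀ x, f x ≠ ⊤)
    (h : ∫⁻ x, f x ∂ν < ⊤) : SFinite ν := by
  have : IsFiniteMeasure (ν.withDensity f) := isFiniteMeasure_withDensity h.ne
  rw [← withDensity_inv_same (μ := ν) hf (ae_of_all _ hf0) (ae_of_all _ hftop)]
  infer_instance

theorem muSym_mono (μ : Measure ℝ) : Monotone (muSym μ) := fun _ _ h =>
  measure_mono (Ioo_subset_Ioo (neg_le_neg h) h)

theorem exists_muSym_ne_zero {μ : Measure ℝ} (hμ : μ ≠ 0) (x : ℝ) :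
    ∃ R ≥ x, muSym μ R ≠ 0 := by
  by_contra! h
  refine hμ (Measure.measure_univ_eq_zero.1 ?_)
  have hcover : (univ : Set ℝ) = ⋃ n : ℕ, Ioo (-(max x n)) (max x n) := by
    refine (eq_univ_of_forall fun t => ?_).symm
    obtain ⟨n, hn⟩ := exists_nat_gt |t|
    exact mem_iUnion.2 ⟨n, abs_lt.1 (hn.trans_le (le_max_right _ _))⟩
  rw [hcover, measure_iUnion_null_iff]
  exact fun n => h _ (le_max_left _ _)

theorem im_one_div_sub_mul_I (t r : ℝ) :
    (1 / ((t : ℂ) - (r : ℂ) * Complex.I)).im = r / (t ^ 2 + r ^ 2) := by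
  rw [one_div, Complex.inv_im, Complex.normSq_apply]
  simp [sq]

theorem ofReal_poisson_div {μ : Measure ℝ}
    (hμ : (∫⁻ t : ℝ, ENNReal.ofReal (1 / (1 + t ^ 2)) ∂μ) < ⊤) {r : ℝ} (hr : 0 < r) :
    ENNReal.ofReal (poisson μ ((r : ℂ) * Complex.I) / r) =
      ∫⁻ t, ENNReal.ofReal (1 / (t ^ 2 + r ^ 2)) ∂μ := by
  have hdiv : poisson μ ((r : ℂ) * Complex.I) / r = ∫ t, 1 / (t ^ 2 + r ^ 2) ∂μ := by
    rw [poisson, ← integral_div]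
    refine integral_congr_ae (ae_of_all _ fun t => ?_)
    simp only [im_one_div_sub_mul_I]
    field_simp
  have hbase : Integrable (fun t : ℝ => 1 / (1 + t ^ 2)) μ := by
    refine ⟨(by fun_prop : Measurable fun t : ℝ => 1 / (1 + t ^ 2)).aestronglyMeasurable, ?_⟩
    rwa [hasFiniteIntegral_iff_ofReal (ae_of_all _ fun t => by positivity)]
  rw [hdiv, ofReal_integral_eq_lintegral_ofReal _ (ae_of_all _ fun t => by positivity)]
  refine (hbase.const_mul (1 + 1 / r ^ 2)).mono'
    (by fun_prop : Measurable fun t : ℝ => 1 / (t ^ 2 + r ^ 2)).aestronglyMeasurable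
    (ae_of_all _ fun t => ?_)
  rw [Real.norm_of_nonneg (by positivity), mul_one_div,
    div_le_div_iff₀ (by positivity) (by positivity)]
  have hexpand : (1 + 1 / r ^ 2) * (t ^ 2 + r ^ 2) = 1 + t ^ 2 + r ^ 2 + t ^ 2 / r ^ 2 := by
    field_simp
    ring
  rw [hexpand]
  have : 0 ≤ r ^ 2 + t ^ 2 / r ^ 2 := by positivity
  linarith

theorem lintegral_Ioi_muSym_mul (μ : Measure ℝ) [SFinite μ] {r : ℝ} (hr : 0 < r) :
    ∫⁻ s in Ioi r, muSym μ s * ENNReal.ofReal (1 / s ^ 3) =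
      ∫⁻ t, ENNReal.ofReal (1 / (2 * max |t| r ^ 2)) ∂μ := by
  have hφ : Measurable fun t : ℝ => max |t| r := by fun_prop
  have hw : Measurable fun s : ℝ => ENNReal.ofReal (1 / s ^ 3) := by fun_prop
  calc ∫⁻ s in Ioi r, muSym μ s * ENNReal.ofReal (1 / s ^ 3)
      = ∫⁻ s, ENNReal.ofReal (1 / s ^ 3) * μ {t | max |t| r < s} := by
        rw [← lintegral_indicator measurableSet_Ioi]
        refine lintegral_congr fun s => ?_
        by_cases hs : r < s
        · have : {t : ℝ | max |t| r < s} = Ioo (-s) s := by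
            ext t
            simp [hs, abs_lt]
          rw [indicator_of_mem (mem_Ioi.2 hs), this, mul_comm, muSym]
        · simp [hs]
    _ = ∫⁻ t, ENNReal.ofReal (1 / (2 * max |t| r ^ 2)) ∂μ := by
        rw [← lintegral_lintegral_Ioi_comp μ hφ hw]
        exact lintegral_congr fun t =>
          lintegral_Ioi_ofReal_one_div_cube (hr.trans_le (le_max_right _ _))

theorem lintegral_Ioi_muSym_mul_le (μ : Measure ℝ) [SFinite μ] {r : ℝ} (hr : 0 < r) :
    ∫⁻ s in Ioi r, muSym μ s * ENNReal.ofReal (1 / s ^ 3) ≤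
      ∫⁻ t, ENNReal.ofReal (1 / (t ^ 2 + r ^ 2)) ∂μ := by
  rw [lintegral_Ioi_muSym_mul μ hr]
  refine lintegral_mono fun t => ENNReal.ofReal_le_ofReal ?_
  have ht : t ^ 2 ≤ max |t| r ^ 2 := by
    rw [← sq_abs t]
    exact pow_le_pow_left₀ (abs_nonneg t) (le_max_left _ _) 2
  have hr' : r ^ 2 ≤ max |t| r ^ 2 := pow_le_pow_left₀ hr.le (le_max_right _ _) 2
  exact one_div_le_one_div_of_le (by positivity) (by linarith)

theorem le_two_mul_lintegral_Ioi_muSym_mul (μ : Measure ℝ) [SFinite μ] {r : ℝ} (hr : 0 < r) :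
    ∫⁻ t, ENNReal.ofReal (1 / (t ^ 2 + r ^ 2)) ∂μ ≤
      2 * ∫⁻ s in Ioi r, muSym μ s * ENNReal.ofReal (1 / s ^ 3) := by
  rw [lintegral_Ioi_muSym_mul μ hr, ← lintegral_const_mul' _ _ ENNReal.ofNat_ne_top]
  refine lintegral_mono fun t => ?_
  have hmax : 0 < max |t| r := hr.trans_le (le_max_right _ _)
  have hle : max |t| r ^ 2 ≤ t ^ 2 + r ^ 2 := by
    rcases max_choice |t| r with h | h <;> rw [h]
    · rw [sq_abs]
      linarith [sq_nonneg r]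
    · linarith [sq_nonneg t]
  rw [← ENNReal.ofReal_ofNat, ← ENNReal.ofReal_mul (by norm_num)]
  refine ENNReal.ofReal_le_ofReal ?_
  calc 1 / (t ^ 2 + r ^ 2) ≤ 1 / max |t| r ^ 2 := one_div_le_one_div_of_le (by positivity) hle
    _ = 2 * (1 / (2 * max |t| r ^ 2)) := by field_simp

theorem lintegral_Ici_lintegral_Ioi {ξ : Measure ℝ} {r0 : ℝ}
    (hξ : ∀ R, ξ (Ico r0 R) < ⊤) {w : ℝ → ℝ≥0∞} (hw : Measurable w) :
    ∫⁻ r in Ici r0, (∫⁻ s in Ioi r, w s) ∂ξ = ∫⁻ s in Ici r0, w s * ξ (Ico r0 s) := by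
  have hIio : ∀ s, ξ.restrict (Ici r0) (Iio s) = ξ (Ico r0 s) := fun s => by
    rw [Measure.restrict_apply measurableSet_Iio, inter_comm, Ici_inter_Iio]
  have : SigmaFinite (ξ.restrict (Ici r0)) := by
    refine ⟨⟨⟨fun n : ℕ => Iio (n : ℝ), fun _ => trivial, fun n => ?_, ?_⟩⟩⟩
    · exact (hIio n).trans_lt (hξ n)
    · exact eq_univ_of_forall fun t => mem_iUnion.2 (exists_nat_gt t)
  rw [lintegral_lintegral_Ioi_comp (φ := fun r => r) _ measurable_id hw,
    ← lintegral_indicator measurableSet_Ici]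
  refine lintegral_congr fun s => ?_
  change w s * ξ.restrict (Ici r0) (Iio s) = _
  rw [hIio]
  by_cases hs : r0 ≤ s
  · rw [indicator_of_mem (mem_Ici.2 hs)]
  · rw [indicator_of_notMem (by simpa using hs), Ico_eq_empty (by simpa using (le_of_not_ge hs)),
      measure_empty, mul_zero]

/-- If `ξ` has infinite mass on a bounded interval, both iterated integrals of a weight that
does not vanish near infinity are infinite. -/
theorem lintegral_Ici_eq_top_of_measure_Ico_eq_top {ξ : Measure ℝ} {r0 R : ℝ}
    (hξ : ξ (Ico r0 R) = ⊤) {w : ℝ → ℝ≥0∞} (hw : Measurable w)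
    (hR : ∫⁻ s in Ioi R, w s ≠ 0) :
    ∫⁻ r in Ici r0, (∫⁻ s in Ioi r, w s) ∂ξ = ⊤ ∧
      ∫⁻ s in Ici r0, w s * ξ (Ico r0 s) = ⊤ := by
  have hlt : r0 < R := by
    by_contra! h
    simp [Ico_eq_empty (not_lt.2 h)] at hξ
  constructor <;> refine top_le_iff.1 ?_
  · calc (⊤ : ℝ≥0∞) = ∫⁻ _ in Ico r0 R, (∫⁻ s in Ioi R, w s) ∂ξ := by
          rw [setLIntegral_const, hξ, ENNReal.mul_top hR]
      _ ≤ ∫⁻ r in Ico r0 R, (∫⁻ s in Ioi r, w s) ∂ξ :=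
          setLIntegral_mono' measurableSet_Ico fun r hr =>
            lintegral_mono_set (Ioi_subset_Ioi hr.2.le)
      _ ≤ ∫⁻ r in Ici r0, (∫⁻ s in Ioi r, w s) ∂ξ := lintegral_mono_set Ico_subset_Ici_self
  · calc (⊤ : ℝ≥0∞) = ∫⁻ s in Ioi R, w s * ⊤ := by
          rw [lintegral_mul_const _ hw, ENNReal.mul_top hR]
      _ ≤ ∫⁻ s in Ioi R, w s * ξ (Ico r0 s) := by
          refine setLIntegral_mono' measurableSet_Ioi fun s hs => mul_le_mul_right ?_ _
          rw [← hξ]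
          exact measure_mono (Ico_subset_Ico_right (le_of_lt hs))
      _ ≤ ∫⁻ s in Ici r0, w s * ξ (Ico r0 s) :=
          lintegral_mono_set fun s hs => hlt.le.trans (le_of_lt hs)

theorem lintegral_Ioi_muSym_mul_ne_zero {μ : Measure ℝ} {R : ℝ} (hR : 0 < R)
    (h : muSym μ R ≠ 0) : ∫⁻ s in Ioi R, muSym μ s * ENNReal.ofReal (1 / s ^ 3) ≠ 0 := by
  refine (lt_of_lt_of_le ?_ (setLIntegral_mono' (f := fun s => muSym μ R *
    ENNReal.ofReal (1 / s ^ 3)) measurableSet_Ioi fun s hs =>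
      mul_le_mul_left (muSym_mono μ (le_of_lt hs)) _)).ne'
  rw [lintegral_const_mul _ (by fun_prop), lintegral_Ioi_ofReal_one_div_cube hR]
  exact ENNReal.mul_pos h (ENNReal.ofReal_pos.2 (by positivity)).ne'

theorem lintegral_Ici_lintegral_Ioi_muSym_lt_top_iff {μ : Measure ℝ} (ξ : Measure ℝ) {r0 : ℝ}
    (hr0 : 0 < r0) :
    (∫⁻ r in Ici r0, (∫⁻ s in Ioi r, muSym μ s * ENNReal.ofReal (1 / s ^ 3)) ∂ξ) < ⊤ ↔
      (∫⁻ s in Ici r0, muSym μ s * ENNReal.ofReal (1 / s ^ 3) * ξ (Ico r0 s)) < ⊤ := by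
  have hw : Measurable fun s => muSym μ s * ENNReal.ofReal (1 / s ^ 3) :=
    (muSym_mono μ).measurable.mul (by fun_prop)
  rcases eq_or_ne μ 0 with rfl | hμ
  · simp [muSym]
  by_cases hξ : ∀ R, ξ (Ico r0 R) < ⊤
  · rw [lintegral_Ici_lintegral_Ioi hξ hw]
  · push Not at hξ
    obtain ⟨R₁, hR₁⟩ := hξ
    obtain ⟨R, hR, hne⟩ := exists_muSym_ne_zero hμ (max r0 R₁)
    have htop : ξ (Ico r0 R) = ⊤ := top_le_iff.1 <|
      hR₁.trans (measure_mono (Ico_subset_Ico_right ((le_max_right _ _).trans hR)))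
    have hRpos : 0 < R := hr0.trans_le ((le_max_left _ _).trans hR)
    obtain ⟨h₁, h₂⟩ := lintegral_Ici_eq_top_of_measure_Ico_eq_top htop hw
      (lintegral_Ioi_muSym_mul_ne_zero hRpos hne)
    rw [h₁, h₂]

/-- Lemma 4.8 (Abelian–Tauberian lemma for the Poisson integral). -/
theorem stmt11 (μ : Measure ℝ)
    (hμ : (∫⁻ t : ℝ, ENNReal.ofReal (1 / (1 + t ^ 2)) ∂μ) < ⊤)
    (r0 : ℝ) (hr0 : 0 < r0) (ξ : Measure ℝ) (hξ : ξ (Set.Iio r0) = 0) :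
    (∫⁻ r in Set.Ici r0,
        ENNReal.ofReal (poisson μ ((r : ℂ) * Complex.I) / r) ∂ξ) < ⊤ ↔
      (∫⁻ r in Set.Ici r0,
        muSym μ r * ξ (Set.Ico r0 r) * ENNReal.ofReal (1 / r ^ 3)) < ⊤ := by
  have hμs : SFinite μ := sFinite_of_lintegral_lt_top (by fun_prop)
    (fun t => (ENNReal.ofReal_pos.2 (by positivity)).ne') (fun t => ENNReal.ofReal_ne_top) hμ
  have hcomm : ∀ r, muSym μ r * ξ (Set.Ico r0 r) * ENNReal.ofReal (1 / r ^ 3) =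
      muSym μ r * ENNReal.ofReal (1 / r ^ 3) * ξ (Set.Ico r0 r) := fun r => mul_right_comm _ _ _
  rw [setLIntegral_congr_fun measurableSet_Ici fun r hr =>
    ofReal_poisson_div hμ (hr0.trans_le hr), lintegral_congr hcomm,
    ← lintegral_Ici_lintegral_Ioi_muSym_lt_top_iff ξ hr0]
  constructor <;> intro h
  · exact (setLIntegral_mono' measurableSet_Ici fun r hr =>
      lintegral_Ioi_muSym_mul_le μ (hr0.trans_le hr)).trans_lt h
  · refine (setLIntegral_mono' measurableSet_Ici fun r hr =>
      le_two_mul_lintegral_Ioi_muSym_mul μ (hr0.trans_le hr)).trans_lt ?_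
    rw [lintegral_const_mul' _ _ ENNReal.ofNat_ne_top]
    exact ENNReal.mul_lt_top ENNReal.ofNat_lt_top h

end
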